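/- arXiv:2110.01197 — 2 statements merged into one kernel-verified Lean document; each statement's English description precedes it below -/
import Mathlib

section
/- Let n ≥ 1, let p⃗, s⃗ be n-tuples with 1 ≤ pᵢ, sᵢ < ∞, and let 1 ≤ α ≤ ∞ satisfy (1/n)Σᵢ 1/sᵢ ≤ 1/α ≤ (1/n)Σᵢ 1/pᵢ. Then for every locally integrable f on ℝⁿ: sup_{r>0} ‖St_r^{(α)}(f)‖_{p⃗,s⃗} = ‖f‖_{p⃗,s⃗,α}. -/
open MeasureTheory ENNReal Filter Topology Set

noncomputable section

namespace MixedAmalgam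

/-- `L^p` norm over `ℝ` of an `ℝ≥0∞`-valued function, with the usual
modification (`essSup`) for `p = ∞`. -/
def lpInt (p : ℝ≥0∞) (g : ℝ → ℝ≥0∞) : ℝ≥0∞ :=
  if p = ∞ then essSup g volume else (∫⁻ t, g t ^ p.toReal) ^ (1 / p.toReal)

/-- `ℓ^p` norm over `ℤ` of an `ℝ≥0∞`-valued family, with the usual
modification for `p = ∞`. -/
def lpSum (p : ℝ≥0∞) (g : ℤ → ℝ≥0∞) : ℝ≥0∞ :=
  if p = ∞ then ⨆ k, g k else (∑' k, g k ^ p.toReal) ^ (1 / p.toReal)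

/-- Iterated mixed Lebesgue norm of an `ℝ≥0∞`-valued function on `ℝⁿ`,
taking the `L^{p₁}` norm in the first variable innermost, and the `L^{pₙ}`
norm in the last variable outermost. -/
def mixedE : (n : ℕ) → (Fin n → ℝ≥0∞) → ((Fin n → ℝ) → ℝ≥0∞) → ℝ≥0∞
  | 0, _, g => g Fin.elim0
  | n + 1, p, g =>
    lpInt (p (Fin.last n)) fun t =>
      mixedE n (fun i => p i.castSucc) fun x => g (Fin.snoc x t)

/-- Mixed-norm Lebesgue norm `‖f‖_{L^{p⃗}}` of a real-valued function on `ℝⁿ`. -/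
def mixedLp (n : ℕ) (p : Fin n → ℝ≥0∞) (f : (Fin n → ℝ) → ℝ) : ℝ≥0∞ :=
  mixedE n p fun x => (‖f x‖₊ : ℝ≥0∞)

/-- Iterated mixed `ℓ^{s⃗}` norm of an `ℝ≥0∞`-valued family indexed by `ℤⁿ`. -/
def mixedSeq : (n : ℕ) → (Fin n → ℝ≥0∞) → ((Fin n → ℤ) → ℝ≥0∞) → ℝ≥0∞
  | 0, _, a => a Fin.elim0
  | n + 1, s, a =>
    lpSum (s (Fin.last n)) fun k =>
      mixedSeq n (fun i => s i.castSucc) fun m => a (Fin.snoc m k)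

/-- Open Euclidean ball of center `y` and radius `r` in `ℝⁿ`. -/
def eball (n : ℕ) (y : Fin n → ℝ) (r : ℝ) : Set (Fin n → ℝ) :=
  {x | Real.sqrt (∑ i, (x i - y i) ^ 2) < r}

/-- `Σᵢ 1/pᵢ` as a real number. -/
def invSum (n : ℕ) (p : Fin n → ℝ≥0∞) : ℝ :=
  ∑ i, (1 / p i).toReal

/-- The `(L^{p⃗},L^{s⃗})` amalgam norm computed with balls of radius `r`. -/
def amalgamNormR (n : ℕ) (p s : Fin n → ℝ≥0∞) (r : ℝ) (f : (Fin n → ℝ) → ℝ) : ℝ≥0∞ :=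
  mixedE n s fun y => mixedLp n p ((eball n y r).indicator f)

/-- The amalgam norm `‖f‖_{(L^{p⃗},L^{s⃗})}`. -/
def amalgamNorm (n : ℕ) (p s : Fin n → ℝ≥0∞) (f : (Fin n → ℝ) → ℝ) : ℝ≥0∞ :=
  amalgamNormR n p s 1 f

/-- The amalgam norm `‖f‖_{(L^{p⃗},L^{s⃗})^α}`. -/
def amalgamNormA (n : ℕ) (p s : Fin n → ℝ≥0∞) (α : ℝ≥0∞) (f : (Fin n → ℝ) → ℝ) : ℝ≥0∞ :=
  ⨆ (r : ℝ) (_ : 0 < r),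
    mixedE n s fun y =>
      volume (eball n y r) ^
          ((1 / α).toReal - invSum n p / (n : ℝ) - invSum n s / (n : ℝ)) *
        mixedLp n p ((eball n y r).indicator f)

/-- The amalgam norm `‖·‖_{(L^{p⃗},L^{s⃗})^α}` for `ℝ≥0∞`-valued functions. -/
def amalgamNormAE (n : ℕ) (p s : Fin n → ℝ≥0∞) (α : ℝ≥0∞)
    (g : (Fin n → ℝ) → ℝ≥0∞) : ℝ≥0∞ :=
  ⨆ (r : ℝ) (_ : 0 < r),
    mixedE n s fun y =>
      volume (eball n y r) ^
          ((1 / α).toReal - invSum n p / (n : ℝ) - invSum n s / (n : ℝ)) *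
        mixedE n p ((eball n y r).indicator g)

/-- The cube `Q_{r,k} = r(k + [0,1)ⁿ)`. -/
def qcube (n : ℕ) (r : ℝ) (k : Fin n → ℤ) : Set (Fin n → ℝ) :=
  {x | ∀ i, r * (k i : ℝ) ≤ x i ∧ x i < r * ((k i : ℝ) + 1)}

/-- The discrete amalgam norm `_r‖f‖_{p⃗,s⃗}`. -/
def discNormR (n : ℕ) (p s : Fin n → ℝ≥0∞) (r : ℝ) (f : (Fin n → ℝ) → ℝ) : ℝ≥0∞ :=
  mixedSeq n s fun k => mixedLp n p ((qcube n r k).indicator f)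

/-- The discrete amalgam norm `‖f‖_{p⃗,s⃗} = _1‖f‖_{p⃗,s⃗}`. -/
def discNorm (n : ℕ) (p s : Fin n → ℝ≥0∞) (f : (Fin n → ℝ) → ℝ) : ℝ≥0∞ :=
  discNormR n p s 1 f

/-- The discrete amalgam norm
`‖f‖_{p⃗,s⃗,α} = sup_{r>0} r^{n/α - Σᵢ 1/pᵢ} · _r‖f‖_{p⃗,s⃗}`. -/
def discNormA (n : ℕ) (p s : Fin n → ℝ≥0∞) (α : ℝ≥0∞) (f : (Fin n → ℝ) → ℝ) : ℝ≥0∞ :=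
  ⨆ (r : ℝ) (_ : 0 < r),
    ENNReal.ofReal (r ^ ((n : ℝ) * (1 / α).toReal - invSum n p)) * discNormR n p s r f

/-- Membership in `(L^{p⃗},L^{s⃗})^α(ℝⁿ)` (continuous form). -/
def memA (n : ℕ) (p s : Fin n → ℝ≥0∞) (α : ℝ≥0∞) (f : (Fin n → ℝ) → ℝ) : Prop :=
  LocallyIntegrable f volume ∧ amalgamNormA n p s α f < ∞

/-- Membership in `(L^{p⃗},ℓ^{s⃗})(ℝⁿ)`. -/
def memD (n : ℕ) (p s : Fin n → ℝ≥0∞) (f : (Fin n → ℝ) → ℝ) : Prop :=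
  LocallyIntegrable f volume ∧ discNorm n p s f < ∞

/-- Membership in `(L^{p⃗},ℓ^{s⃗})^α(ℝⁿ)`. -/
def memDA (n : ℕ) (p s : Fin n → ℝ≥0∞) (α : ℝ≥0∞) (f : (Fin n → ℝ) → ℝ) : Prop :=
  LocallyIntegrable f volume ∧ discNormA n p s α f < ∞

/-- The dilation `St_r^{(α)} f = r^{-n/α} f(r⁻¹ ·)`. -/
def dil (n : ℕ) (α : ℝ≥0∞) (r : ℝ) (f : (Fin n → ℝ) → ℝ) : (Fin n → ℝ) → ℝ :=
  fun x => r ^ (-((n : ℝ) * (1 / α).toReal)) * f (r⁻¹ • x)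

/-- A block decomposition `f = Σ_j c_j St_{r_j}^{(α')} f_j` converging in `L¹_loc`. -/
structure BlockDecomp (n : ℕ) (p' s' : Fin n → ℝ≥0∞) (α' : ℝ≥0∞) (f : (Fin n → ℝ) → ℝ)
    (c : ℕ → ℝ) (rr : ℕ → ℝ) (g : ℕ → (Fin n → ℝ) → ℝ) : Prop where
  csummable : Summable fun j => |c j|
  rpos : ∀ j, 0 < rr j
  gloc : ∀ j, LocallyIntegrable (g j) volume
  gnorm : ∀ j, discNorm n p' s' (g j) ≤ 1
  conv : ∀ K : Set (Fin n → ℝ), IsCompact K →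
    Tendsto (fun J : ℕ =>
        ∫⁻ x in K,
          (‖f x - ∑ j ∈ Finset.range J, c j * dil n α' (rr j) (g j) x‖₊ : ℝ≥0∞))
      atTop (𝓝 0)

/-- Membership in the block space `H(p⃗',s⃗',α')`. -/
def memH (n : ℕ) (p' s' : Fin n → ℝ≥0∞) (α' : ℝ≥0∞) (f : (Fin n → ℝ) → ℝ) : Prop :=
  LocallyIntegrable f volume ∧ ∃ c rr g, BlockDecomp n p' s' α' f c rr g

/-- The norm of the block space `H(p⃗',s⃗',α')`. -/
def hNorm (n : ℕ) (p' s' : Fin n → ℝ≥0∞) (α' : ℝ≥0∞) (f : (Fin n → ℝ) → ℝ) : ℝ≥0∞ :=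
  ⨅ (c : ℕ → ℝ) (rr : ℕ → ℝ) (g : ℕ → (Fin n → ℝ) → ℝ)
    (_ : BlockDecomp n p' s' α' f c rr g), ENNReal.ofReal (∑' j, |c j|)

/-- The fractional integral operator `I_γ`. -/
def fracInt (n : ℕ) (γ : ℝ) (f : (Fin n → ℝ) → ℝ) : (Fin n → ℝ) → ℝ :=
  fun x => ∫ y, f y / Real.sqrt (∑ i, (x i - y i) ^ 2) ^ ((n : ℝ) - γ)

/-- The fractional maximal operator `M_γ`. -/
def fracMax (n : ℕ) (γ : ℝ) (f : (Fin n → ℝ) → ℝ) : (Fin n → ℝ) → ℝ≥0∞ :=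
  fun x => ⨆ (y : Fin n → ℝ) (r : ℝ) (_ : 0 < r) (_ : x ∈ eball n y r),
    volume (eball n y r) ^ (γ / (n : ℝ) - 1) * ∫⁻ z in eball n y r, (‖f z‖₊ : ℝ≥0∞)

/-- The commutator `[b, I_γ] f`. -/
def commFracInt (n : ℕ) (γ : ℝ) (b f : (Fin n → ℝ) → ℝ) : (Fin n → ℝ) → ℝ :=
  fun x => ∫ y, (b x - b y) * f y / Real.sqrt (∑ i, (x i - y i) ^ 2) ^ ((n : ℝ) - γ)

/-- The mean value `b_B` of `b` over the ball `B(y,r)`. -/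
def ballAvg (n : ℕ) (b : (Fin n → ℝ) → ℝ) (y : Fin n → ℝ) (r : ℝ) : ℝ :=
  (volume (eball n y r)).toReal⁻¹ * ∫ x in eball n y r, b x

/-- The `BMO` norm `sup_B (1/|B|) ∫_B |b - b_B|`. -/
def bmoNorm (n : ℕ) (b : (Fin n → ℝ) → ℝ) : ℝ≥0∞ :=
  ⨆ (y : Fin n → ℝ) (r : ℝ) (_ : 0 < r),
    ENNReal.ofReal
      ((volume (eball n y r)).toReal⁻¹ * ∫ x in eball n y r, |b x - ballAvg n b y r|)

theorem aux_scale (ρ : ℝ) (hρ : 0 < ρ) (g : ℝ → ℝ≥0∞) :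
    ∫⁻ t, g (ρ * t) = ENNReal.ofReal (ρ⁻¹) * ∫⁻ t, g t := by
  have h := lintegral_map_equiv (μ := (volume : Measure ℝ)) g
    (Homeomorph.mulLeft₀ ρ hρ.ne').toMeasurableEquiv
  have h2 : (Measure.map (Homeomorph.mulLeft₀ ρ hρ.ne').toMeasurableEquiv (volume : Measure ℝ))
      = ENNReal.ofReal (ρ⁻¹) • volume := by
    have := Real.map_volume_mul_left hρ.ne'
    rw [abs_of_pos (inv_pos.2 hρ)] at this
    exact this
  rw [h2, lintegral_smul_measure] at h
  exact h.symm

theorem aux_lpInt (p : ℝ≥0∞) (hp : 1 ≤ p ∧ p ≠ ∞) (ρ : ℝ) (hρ : 0 < ρ) (c : ℝ≥0∞) (hc : c ≠ ∞)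
    (g : ℝ → ℝ≥0∞) :
    lpInt p (fun t => c * g (ρ * t)) =
      c * ENNReal.ofReal (ρ ^ (-(1 / p).toReal)) * lpInt p g := by
  have hp0 : 0 < p.toReal := ENNReal.toReal_pos (by rintro rfl; simp at hp) hp.2
  simp only [lpInt, if_neg hp.2]
  simp only [ENNReal.mul_rpow_of_nonneg _ _ hp0.le]
  rw [lintegral_const_mul' _ _ (ENNReal.rpow_ne_top_of_nonneg hp0.le hc),
    aux_scale ρ hρ (fun t => g t ^ p.toReal)]
  have h1 : 0 ≤ 1 / p.toReal := by positivity
  rw [ENNReal.mul_rpow_of_nonneg _ _ h1, ENNReal.mul_rpow_of_nonneg _ _ h1,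
    ← ENNReal.rpow_mul, mul_one_div_cancel hp0.ne', ENNReal.rpow_one,
    ENNReal.ofReal_rpow_of_pos (inv_pos.2 hρ), Real.inv_rpow hρ.le, Real.rpow_neg hρ.le,
    ENNReal.toReal_div, ENNReal.toReal_one, mul_assoc]

theorem aux_lpSum (p : ℝ≥0∞) (hp : 1 ≤ p ∧ p ≠ ∞) (c : ℝ≥0∞) (g : ℤ → ℝ≥0∞) :
    lpSum p (fun t => c * g t) = c * lpSum p g := by
  have hp0 : 0 < p.toReal := ENNReal.toReal_pos (by rintro rfl; simp at hp) hp.2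
  simp only [lpSum, if_neg hp.2]
  simp only [ENNReal.mul_rpow_of_nonneg _ _ hp0.le]
  have h1 : 0 ≤ 1 / p.toReal := by positivity
  rw [ENNReal.tsum_mul_left, ENNReal.mul_rpow_of_nonneg _ _ h1,
    ← ENNReal.rpow_mul, mul_one_div_cancel hp0.ne', ENNReal.rpow_one]

theorem aux_mixedSeq (n : ℕ) (s : Fin n → ℝ≥0∞) (hs : ∀ i, 1 ≤ s i ∧ s i ≠ ∞) (c : ℝ≥0∞)
    (a : (Fin n → ℤ) → ℝ≥0∞) :
    mixedSeq n s (fun k => c * a k) = c * mixedSeq n s a := by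
  induction n with
  | zero => rfl
  | succ n ih =>
    simp only [mixedSeq]
    simp only [ih (fun i => s i.castSucc) (fun i => hs _)]
    exact aux_lpSum _ (hs _) _ _

theorem aux_mixedE (n : ℕ) (p : Fin n → ℝ≥0∞) (hp : ∀ i, 1 ≤ p i ∧ p i ≠ ∞) (ρ : ℝ) (hρ : 0 < ρ)
    (c : ℝ≥0∞) (hc : c ≠ ∞) (g : (Fin n → ℝ) → ℝ≥0∞) :
    mixedE n p (fun x => c * g (ρ • x)) =
      c * ENNReal.ofReal (ρ ^ (-invSum n p)) * mixedE n p g := by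
  induction n with
  | zero =>
    simp only [mixedE, invSum, Finset.univ_eq_empty, Finset.sum_empty, neg_zero, Real.rpow_zero,
      ENNReal.ofReal_one, mul_one]
    congr 2
    exact Subsingleton.elim _ _
  | succ n ih =>
    simp only [mixedE]
    have hsn : ∀ (x : Fin n → ℝ) (t : ℝ),
        (ρ • (Fin.snoc x t : Fin (n+1) → ℝ)) = (Fin.snoc (ρ • x) (ρ * t) : Fin (n+1) → ℝ) := by
      intro x t
      ext i
      refine Fin.lastCases ?_ (fun j => ?_) i <;> simp
    simp only [hsn]
    have := fun t : ℝ => ih (fun i => p i.castSucc) (fun i => hp _)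
      (fun x => g (Fin.snoc x (ρ * t)))
    simp only [this]
    rw [aux_lpInt _ (hp _) ρ hρ _ (ENNReal.mul_ne_top hc ENNReal.ofReal_ne_top)
      (fun t => mixedE n (fun i => p i.castSucc) fun x => g (Fin.snoc x t))]
    congr 1
    rw [mul_assoc, ← ENNReal.ofReal_mul (by positivity), ← Real.rpow_add hρ]
    congr 3
    simp only [invSum, Fin.sum_univ_castSucc]
    ring_nf

theorem aux_main (n : ℕ) (p s : Fin n → ℝ≥0∞) (α : ℝ≥0∞)
    (hp : ∀ i, 1 ≤ p i ∧ p i ≠ ∞) (hs : ∀ i, 1 ≤ s i ∧ s i ≠ ∞)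
    (f : (Fin n → ℝ) → ℝ) (r : ℝ) (hr : 0 < r) :
    discNorm n p s (dil n α r f) =
      ENNReal.ofReal (r⁻¹ ^ ((n : ℝ) * (1 / α).toReal - invSum n p)) *
        discNormR n p s r⁻¹ f := by
  simp only [discNorm, discNormR]
  rw [← aux_mixedSeq n s hs]
  congr 1
  ext k
  simp only [mixedLp]
  have hfun : (fun x => (‖(qcube n 1 k).indicator (dil n α r f) x‖₊ : ℝ≥0∞)) =
      fun x => ENNReal.ofReal (r ^ (-((n : ℝ) * (1 / α).toReal))) *
        (fun y => (‖(qcube n r⁻¹ k).indicator f y‖₊ : ℝ≥0∞)) (r⁻¹ • x) := by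
    ext x
    have hmem : r⁻¹ • x ∈ qcube n r⁻¹ k ↔ x ∈ qcube n 1 k := by
      have hi := inv_pos.2 hr
      simp only [qcube, Set.mem_ofPred_eq, Pi.smul_apply, smul_eq_mul, one_mul,
        mul_le_mul_iff_right₀ hi, mul_lt_mul_iff_right₀ hi]
    by_cases hx : x ∈ qcube n 1 k
    · simp only [Set.indicator_of_mem hx, Set.indicator_of_mem (hmem.2 hx), dil, nnnorm_mul,
        ENNReal.coe_mul]
      congr 1
      exact Real.enorm_of_nonneg (by positivity)
    · simp [Set.indicator_of_notMem hx, Set.indicator_of_notMem (mt hmem.1 hx)]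
  rw [hfun, aux_mixedE n p hp r⁻¹ (inv_pos.2 hr) _ ENNReal.ofReal_ne_top
    (fun y => (‖(qcube n r⁻¹ k).indicator f y‖₊ : ℝ≥0∞)),
    ← ENNReal.ofReal_mul (by positivity), sub_eq_add_neg, Real.rpow_add (inv_pos.2 hr)]
  congr 3
  rw [Real.inv_rpow hr.le, Real.rpow_neg hr.le]

/-- `sup_{r>0} ‖St_r^{(α)} f‖_{p⃗,s⃗} = ‖f‖_{p⃗,s⃗,α}`. -/
theorem statement9 (n : ℕ) (hn : 1 ≤ n) (p s : Fin n → ℝ≥0∞) (α : ℝ≥0∞)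
    (hp : ∀ i, 1 ≤ p i ∧ p i ≠ ∞) (hs : ∀ i, 1 ≤ s i ∧ s i ≠ ∞) (hα : 1 ≤ α)
    (hα1 : invSum n s / (n : ℝ) ≤ (1 / α).toReal)
    (hα2 : (1 / α).toReal ≤ invSum n p / (n : ℝ)) :
    ∀ f : (Fin n → ℝ) → ℝ, LocallyIntegrable f volume →
      (⨆ (r : ℝ) (_ : 0 < r), discNorm n p s (dil n α r f)) = discNormA n p s α f := by
  intro f _
  simp only [discNormA]
  apply le_antisymm
  · refine iSup₂_le fun r hr => ?_
    rw [aux_main n p s α hp hs f r hr]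
    exact le_iSup₂ (f := fun (r : ℝ) (_ : 0 < r) =>
      ENNReal.ofReal (r ^ ((n : ℝ) * (1 / α).toReal - invSum n p)) * discNormR n p s r f)
      r⁻¹ (inv_pos.2 hr)
  · refine iSup₂_le fun r hr => ?_
    have h := aux_main n p s α hp hs f r⁻¹ (inv_pos.2 hr)
    rw [inv_inv] at h
    rw [← h]
    exact le_iSup₂ (f := fun (r : ℝ) (_ : 0 < r) => discNorm n p s (dil n α r f))
      r⁻¹ (inv_pos.2 hr)

end MixedAmalgam

end
end

section
/- Let n ≥ 1, let p⃗, s⃗ be n-tuples with 1 ≤ pᵢ, sᵢ ≤ ∞ and let 1 ≤ α ≤ ∞ satisfy (1/n)Σᵢ 1/sᵢ ≤ 1/α ≤ (1/n)Σᵢ 1/pᵢ, with conjugate exponents p⃗′, s⃗′, α′. If g ∈ (L^{p⃗},ℓ^{s⃗})^α(ℝⁿ) and f ∈ H(p⃗′,s⃗′,α′), then fg ∈ L¹(ℝⁿ) and |∫_{ℝⁿ} f(x)g(x) dx| ≤ ‖g‖_{p⃗,s⃗,α} · ‖f‖_{H(p⃗′,s⃗′,α′)}. -/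
open MeasureTheory ENNReal Filter Topology Set

noncomputable section

namespace MixedAmalgam

def nrm {Ω : Type*} [MeasurableSpace Ω] (μ : Measure Ω) (p : ℝ≥0∞) (g : Ω → ℝ≥0∞) : ℝ≥0∞ :=
  if p = ∞ then essSup g μ else (∫⁻ t, g t ^ p.toReal ∂μ) ^ (1 / p.toReal)

lemma lpInt_eq (p : ℝ≥0∞) (g : ℝ → ℝ≥0∞) : lpInt p g = nrm volume p g := rfl

lemma lpSum_eq (p : ℝ≥0∞) (g : ℤ → ℝ≥0∞) : lpSum p g = nrm Measure.count p g := by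
  unfold lpSum nrm
  rw [essSup_count, lintegral_count]

lemma ptop_of_one {p' : ℝ≥0∞} (h : 1 / (∞ : ℝ≥0∞) + 1 / p' = 1) : p' = 1 := by
  simpa using h

lemma holder_top {Ω : Type*} [MeasurableSpace Ω] (μ : Measure Ω) {f g : Ω → ℝ≥0∞}
    (hg : Measurable g) :
    ∫⁻ x, f x * g x ∂μ ≤ nrm μ ∞ f * nrm μ 1 g := by
  simp only [nrm, if_true, ENNReal.one_ne_top, if_false, ENNReal.toReal_one, ENNReal.rpow_one,
    div_one]
  rw [← lintegral_const_mul _ hg]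
  apply lintegral_mono_ae
  filter_upwards [ENNReal.ae_le_essSup f] with x hx
  gcongr

lemma holder_nrm {Ω : Type*} [MeasurableSpace Ω] (μ : Measure Ω) {p p' : ℝ≥0∞}
    (h : 1 / p + 1 / p' = 1) {f g : Ω → ℝ≥0∞} (hf : Measurable f) (hg : Measurable g) :
    ∫⁻ x, f x * g x ∂μ ≤ nrm μ p f * nrm μ p' g := by
  by_cases hp : p = ∞
  · subst hp
    rw [ptop_of_one h]
    exact holder_top μ hg
  by_cases hp' : p' = ∞
  · subst hp'
    rw [add_comm] at h
    rw [ptop_of_one h, mul_comm]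
    simp_rw [mul_comm (f _)]
    exact holder_top μ hf
  have hc : ENNReal.HolderConjugate p p' := ⟨by simpa using h⟩
  have h0 : p ≠ 0 := by rintro rfl; simp at h
  have h0' : p' ≠ 0 := by rintro rfl; simp at h
  have hr : p.toReal.HolderConjugate p'.toReal := by
    refine ⟨?_, ENNReal.toReal_pos h0 hp, ENNReal.toReal_pos h0' hp'⟩
    have := congrArg ENNReal.toReal h
    rw [ENNReal.toReal_add (by simpa using h0) (by simpa using h0')] at this
    simpa using this
  simp only [nrm, hp, hp', if_false]
  exact ENNReal.lintegral_mul_le_Lp_mul_Lq μ hr hf.aemeasurable hg.aemeasurable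

lemma nrm_congr {Ω : Type*} [MeasurableSpace Ω] (μ : Measure Ω) {p : ℝ≥0∞}
    {f g : Ω → ℝ≥0∞} (h : f =ᵐ[μ] g) : nrm μ p f = nrm μ p g := by
  unfold nrm
  rw [essSup_congr_ae h]
  have : ∫⁻ t, f t ^ p.toReal ∂μ = ∫⁻ t, g t ^ p.toReal ∂μ := by
    apply lintegral_congr_ae
    filter_upwards [h] with x hx
    rw [hx]
  rw [this]

lemma nrm_const_mul {Ω : Type*} [MeasurableSpace Ω] (μ : Measure Ω) {p : ℝ≥0∞} (hp : p ≠ 0)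
    {c : ℝ≥0∞} (hc : c ≠ ∞) (f : Ω → ℝ≥0∞) : nrm μ p (fun x => c * f x) = c * nrm μ p f := by
  unfold nrm
  split_ifs with h
  · exact ENNReal.essSup_const_mul
  · have h0 := ENNReal.toReal_pos hp h
    simp_rw [ENNReal.mul_rpow_of_nonneg _ _ h0.le]
    rw [lintegral_const_mul' _ _ (ENNReal.rpow_ne_top_of_nonneg h0.le hc),
      ENNReal.mul_rpow_of_nonneg _ _ (by positivity), ← ENNReal.rpow_mul,
      mul_one_div_cancel h0.ne', ENNReal.rpow_one]

lemma nrm_mono {Ω : Type*} [MeasurableSpace Ω] (μ : Measure Ω) {p : ℝ≥0∞}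
    {f g : Ω → ℝ≥0∞} (h : ∀ x, f x ≤ g x) : nrm μ p f ≤ nrm μ p g := by
  unfold nrm
  split_ifs
  · exact essSup_mono_ae (Eventually.of_forall h)
  · gcongr
    exact h _

lemma measurable_nrm {Ω γ : Type*} [MeasurableSpace Ω] [MeasurableSpace γ] (μ : Measure Ω)
    [SFinite μ] (p : ℝ≥0∞) {F : γ → Ω → ℝ≥0∞} (hF : Measurable (Function.uncurry F)) :
    Measurable fun c => nrm μ p (F c) := by
  unfold nrm
  split_ifs with h
  · apply measurable_of_Iic
    intro a
    have : (fun c => essSup (F c) μ) ⁻¹' Iic a =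
        {c | μ (Prod.mk c ⁻¹' {z | a < Function.uncurry F z}) = 0} := by
      ext c
      simp only [mem_preimage, mem_Iic, mem_ofPred_eq]
      constructor
      · intro hc
        have : ∀ᵐ t ∂μ, F c t ≤ a := by
          filter_upwards [ENNReal.ae_le_essSup (μ := μ) (F c)] with x hx using hx.trans hc
        rw [ae_iff] at this
        simpa [Set.preimage, Function.uncurry] using this
      · intro hc
        have : ∀ᵐ t ∂μ, F c t ≤ a := by
          rw [ae_iff]
          simpa [Set.preimage, Function.uncurry] using hc
        exact essSup_le_of_ae_le a this
    rw [this]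
    exact measurable_measure_prodMk_left (measurableSet_lt measurable_const hF)
      (measurableSet_singleton 0)
  · have := (hF.pow_const p.toReal).lintegral_prod_right' (ν := μ)
    exact this.pow_const _

lemma measurable_snoc (n : ℕ) :
    Measurable fun z : ℝ × (Fin n → ℝ) => (Fin.snoc z.2 z.1 : Fin (n+1) → ℝ) := by
  rw [measurable_pi_iff]
  intro i
  refine Fin.lastCases ?_ (fun j => ?_) i
  · simpa using measurable_fst
  · simp only [Fin.snoc_castSucc]
    fun_prop

lemma mp_snoc (n : ℕ) :
    MeasurePreserving (fun z : ℝ × (Fin n → ℝ) => (Fin.snoc z.2 z.1 : Fin (n+1) → ℝ))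
      (volume.prod volume) volume := by
  have := (volume_preserving_piFinSuccAbove (fun _ : Fin (n+1) => ℝ) (Fin.last n)).symm
  have e : (fun z : ℝ × (Fin n → ℝ) => (Fin.snoc z.2 z.1 : Fin (n+1) → ℝ)) =
      (MeasurableEquiv.piFinSuccAbove (fun _ : Fin (n+1) => ℝ) (Fin.last n)).symm := by
    ext z : 1
    rw [← Fin.insertNth_last']
    rfl
  rw [e]
  exact this

lemma lintegral_snoc (n : ℕ) {G : (Fin (n+1) → ℝ) → ℝ≥0∞} (hG : Measurable G) :
    ∫⁻ x, G x = ∫⁻ t, ∫⁻ x, G (Fin.snoc x t) := by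
  rw [← (mp_snoc n).lintegral_comp hG]
  exact lintegral_prod _ (hG.comp (measurable_snoc n)).aemeasurable

lemma measurable_mixedE (n : ℕ) (p : Fin n → ℝ≥0∞) {γ : Type} [MeasurableSpace γ]
    {F : γ → (Fin n → ℝ) → ℝ≥0∞} (hF : Measurable (Function.uncurry F)) :
    Measurable fun c => mixedE n p (F c) := by
  induction n generalizing γ with
  | zero =>
    simp only [mixedE]
    exact hF.comp (measurable_id.prodMk measurable_const)
  | succ n ih =>
    simp only [mixedE, lpInt_eq]
    apply measurable_nrm
    have : Measurable (Function.uncurry fun (z : γ × ℝ) (x : Fin n → ℝ) =>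
        F z.1 (Fin.snoc x z.2)) := by
      have h2 : Measurable fun w : (γ × ℝ) × (Fin n → ℝ) =>
          (w.1.1, (Fin.snoc w.2 w.1.2 : Fin (n+1) → ℝ)) := by
        refine measurable_fst.fst.prodMk ?_
        exact (measurable_snoc n).comp (measurable_fst.snd.prodMk measurable_snd)
      exact hF.comp h2
    exact ih (fun i => p i.castSucc) this

lemma mixedE_congr (n : ℕ) (p : Fin n → ℝ≥0∞) {f g : (Fin n → ℝ) → ℝ≥0∞}
    (h : f =ᵐ[volume] g) : mixedE n p f = mixedE n p g := by
  induction n with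
  | zero =>
    simp only [mixedE]
    rw [Filter.EventuallyEq, Measure.volume_pi_eq_dirac (Fin.elim0 : Fin 0 → ℝ), ae_dirac_eq] at h
    exact h
  | succ n ih =>
    simp only [mixedE, lpInt_eq]
    apply nrm_congr
    have h1 := (mp_snoc n).quasiMeasurePreserving.ae h
    filter_upwards [Measure.ae_ae_of_ae_prod h1] with t ht
    exact ih _ ht

lemma holder_mixedE (n : ℕ) (p p' : Fin n → ℝ≥0∞) (h : ∀ i, 1 / p i + 1 / p' i = 1)
    {f g : (Fin n → ℝ) → ℝ≥0∞} (hf : Measurable f) (hg : Measurable g) :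
    ∫⁻ x, f x * g x ≤ mixedE n p f * mixedE n p' g := by
  induction n with
  | zero =>
    simp only [mixedE]
    rw [Measure.volume_pi_eq_dirac (Fin.elim0 : Fin 0 → ℝ), lintegral_dirac]
  | succ n ih =>
    rw [lintegral_snoc n (G := fun x => f x * g x) (hf.mul hg)]
    have hs (u : (Fin (n+1) → ℝ) → ℝ≥0∞) (hu : Measurable u) :
        Measurable (Function.uncurry fun (t : ℝ) (x : Fin n → ℝ) => u (Fin.snoc x t)) :=
      hu.comp (measurable_snoc n)
    simp only [mixedE, lpInt_eq]
    refine le_trans ?_ (holder_nrm volume (h (Fin.last n))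
      (measurable_mixedE n _ (hs f hf)) (measurable_mixedE n _ (hs g hg)))
    apply lintegral_mono
    intro t
    exact ih _ _ (fun i => h i.castSucc) ((hs f hf).of_uncurry_left) ((hs g hg).of_uncurry_left)

lemma holder_mixedSeq (n : ℕ) (p p' : Fin n → ℝ≥0∞) (h : ∀ i, 1 / p i + 1 / p' i = 1)
    (f g : (Fin n → ℤ) → ℝ≥0∞) :
    ∑' x, f x * g x ≤ mixedSeq n p f * mixedSeq n p' g := by
  induction n with
  | zero =>
    simp only [mixedSeq]
    rw [tsum_eq_single Fin.elim0 (fun b hb => (hb (Subsingleton.elim _ _)).elim)]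
  | succ n ih =>
    rw [← (Fin.snocEquiv (fun _ : Fin (n+1) => ℤ)).tsum_eq, ENNReal.tsum_prod']
    simp only [mixedSeq, lpSum_eq]
    refine le_trans ?_ (holder_nrm Measure.count (h (Fin.last n))
      (measurable_of_countable _) (measurable_of_countable _))
    rw [lintegral_count]
    apply ENNReal.tsum_le_tsum
    intro t
    exact ih _ _ (fun i => h i.castSucc) _ _

lemma mixedE_const_mul (n : ℕ) (p : Fin n → ℝ≥0∞) (hp : ∀ i, p i ≠ 0) {c : ℝ≥0∞} (hc : c ≠ ∞)
    (f : (Fin n → ℝ) → ℝ≥0∞) : mixedE n p (fun x => c * f x) = c * mixedE n p f := by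
  induction n with
  | zero => simp only [mixedE]
  | succ n ih =>
    simp only [mixedE, lpInt_eq]
    rw [← nrm_const_mul _ (hp _) hc]
    congr 1
    ext t
    exact ih _ (fun i => hp _) _

lemma mixedSeq_const_mul (n : ℕ) (p : Fin n → ℝ≥0∞) (hp : ∀ i, p i ≠ 0) {c : ℝ≥0∞} (hc : c ≠ ∞)
    (f : (Fin n → ℤ) → ℝ≥0∞) : mixedSeq n p (fun x => c * f x) = c * mixedSeq n p f := by
  induction n with
  | zero => simp only [mixedSeq]
  | succ n ih =>
    simp only [mixedSeq, lpSum_eq]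
    rw [← nrm_const_mul _ (hp _) hc]
    congr 1
    ext t
    exact ih _ (fun i => hp _) _

lemma nrm_eq_eLpNorm {Ω : Type*} [MeasurableSpace Ω] (μ : Measure Ω) {p : ℝ≥0∞} (hp : p ≠ 0)
    (f : Ω → ℝ≥0∞) : nrm μ p f = eLpNorm f p μ := by
  unfold nrm
  split_ifs with h
  · subst h; simp [eLpNormEssSup]
  · rw [eLpNorm_eq_lintegral_rpow_enorm_toReal hp h]; simp

lemma nrm_scale {p : ℝ≥0∞} (hp : p ≠ 0) {r : ℝ} (hr : 0 < r) (f : ℝ → ℝ≥0∞) :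
    nrm volume p (fun t => f (r⁻¹ * t)) = ENNReal.ofReal r ^ (1 / p).toReal * nrm volume p f := by
  rw [nrm_eq_eLpNorm _ hp, nrm_eq_eLpNorm _ hp]
  have h0 : r⁻¹ ≠ 0 := by positivity
  have e : MeasurableEmbedding fun t : ℝ => r⁻¹ * t := measurableEmbedding_mulLeft₀ h0
  have := e.eLpNorm_map_measure (μ := volume) (g := f) (p := p)
  rw [Real.map_volume_mul_left h0, eLpNorm_smul_measure_of_ne_zero (by simpa using hr.ne')] at this
  rw [inv_inv, abs_of_pos hr] at this
  exact this.symm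

lemma mixedE_scale (n : ℕ) (p : Fin n → ℝ≥0∞) (hp : ∀ i, p i ≠ 0) {r : ℝ} (hr : 0 < r)
    (f : (Fin n → ℝ) → ℝ≥0∞) :
    mixedE n p (fun x => f (r⁻¹ • x)) = ENNReal.ofReal (r ^ invSum n p) * mixedE n p f := by
  induction n with
  | zero =>
    simp only [mixedE, invSum]
    rw [Subsingleton.elim (r⁻¹ • Fin.elim0 : Fin 0 → ℝ) Fin.elim0]
    simp
  | succ n ih =>
    simp only [mixedE, lpInt_eq]
    have h1 (t : ℝ) (x : Fin n → ℝ) :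
        r⁻¹ • (Fin.snoc x t : Fin (n+1) → ℝ) = Fin.snoc (r⁻¹ • x) (r⁻¹ * t) := by
      ext i
      refine Fin.lastCases ?_ (fun j => ?_) i <;> simp
    simp_rw [h1]
    have h2 (t : ℝ) := ih (fun i => p i.castSucc) (fun i => hp _)
      (fun x => f (Fin.snoc x (r⁻¹ * t)))
    simp_rw [h2]
    rw [nrm_const_mul _ (hp _) ENNReal.ofReal_ne_top,
      nrm_scale (hp _) hr (fun t => mixedE n _ fun x => f (Fin.snoc x t)), ← mul_assoc]
    congr 1
    rw [ENNReal.ofReal_rpow_of_pos hr, ← ENNReal.ofReal_mul (by positivity), ← Real.rpow_add hr]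
    congr 2
    simp [invSum, Fin.sum_univ_castSucc]

lemma mixedLp_ind_congr (n : ℕ) (p : Fin n → ℝ≥0∞) (S : Set (Fin n → ℝ))
    {f g : (Fin n → ℝ) → ℝ} (h : f =ᵐ[volume] g) :
    mixedLp n p (S.indicator f) = mixedLp n p (S.indicator g) := by
  apply mixedE_congr
  filter_upwards [h] with x hx
  simp only [Set.indicator, hx]

lemma discNormR_congr (n : ℕ) (p s : Fin n → ℝ≥0∞) (r : ℝ)
    {f g : (Fin n → ℝ) → ℝ} (h : f =ᵐ[volume] g) :
    discNormR n p s r f = discNormR n p s r g := by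
  unfold discNormR
  congr 1
  ext k
  exact mixedLp_ind_congr n p _ h

lemma measurableSet_qcube (n : ℕ) (r : ℝ) (k : Fin n → ℤ) : MeasurableSet (qcube n r k) := by
  have : qcube n r k = Set.pi univ fun i => Ico (r * (k i : ℝ)) (r * ((k i : ℝ) + 1)) := by
    ext x; simp [qcube]
  rw [this]
  exact MeasurableSet.univ_pi fun i => measurableSet_Ico

lemma mem_qcube_iff (n : ℕ) {r : ℝ} (hr : 0 < r) (k : Fin n → ℤ) (x : Fin n → ℝ) :
    x ∈ qcube n r k ↔ ∀ i, ⌊r⁻¹ * x i⌋ = k i := by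
  change (∀ i, _) ↔ _
  refine forall_congr' fun i => ?_
  rw [Int.floor_eq_iff, inv_mul_eq_div, le_div_iff₀ hr, div_lt_iff₀ hr, mul_comm r, mul_comm r]

lemma qcube_scale (n : ℕ) {r : ℝ} (hr : 0 < r) (k : Fin n → ℤ) (x : Fin n → ℝ) :
    x ∈ qcube n r k ↔ r⁻¹ • x ∈ qcube n 1 k := by
  rw [mem_qcube_iff n hr, mem_qcube_iff n one_pos]
  simp

lemma holder_disc_meas (n : ℕ) (p s p' s' : Fin n → ℝ≥0∞) (hp : ∀ i, 1 / p i + 1 / p' i = 1)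
    (hs : ∀ i, 1 / s i + 1 / s' i = 1) {r : ℝ} (hr : 0 < r) {f g : (Fin n → ℝ) → ℝ}
    (hf : Measurable f) (hg : Measurable g) :
    ∫⁻ x, (‖f x‖₊ : ℝ≥0∞) * ‖g x‖₊ ≤ discNormR n p s r f * discNormR n p' s' r g := by
  have hU : (⋃ k, qcube n r k) = univ := by
    ext x
    simp only [mem_iUnion, mem_univ, iff_true]
    exact ⟨fun i => ⌊r⁻¹ * x i⌋, (mem_qcube_iff n hr _ _).2 fun i => rfl⟩
  rw [← setLIntegral_univ, ← hU, lintegral_iUnion (measurableSet_qcube n r)]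
  · refine le_trans ?_ (holder_mixedSeq n s s' hs _ _)
    apply ENNReal.tsum_le_tsum
    intro k
    have hm := measurableSet_qcube n r k
    have := holder_mixedE n p p' hp (hf.indicator hm).nnnorm.coe_nnreal_ennreal
      (hg.indicator hm).nnnorm.coe_nnreal_ennreal
    refine le_trans (le_of_eq ?_) this
    rw [← lintegral_indicator hm]
    congr 1
    ext x
    by_cases hx : x ∈ qcube n r k <;> simp [hx]
  · intro k l hkl
    rw [Function.onFun, Set.disjoint_left]
    intro x hx hx'
    rw [mem_qcube_iff n hr] at hx hx'
    exact hkl (funext fun i => (hx i).symm.trans (hx' i))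

lemma holder_disc (n : ℕ) (p s p' s' : Fin n → ℝ≥0∞) (hp : ∀ i, 1 / p i + 1 / p' i = 1)
    (hs : ∀ i, 1 / s i + 1 / s' i = 1) {r : ℝ} (hr : 0 < r) {f g : (Fin n → ℝ) → ℝ}
    (hf : AEMeasurable f) (hg : AEMeasurable g) :
    ∫⁻ x, (‖f x‖₊ : ℝ≥0∞) * ‖g x‖₊ ≤ discNormR n p s r f * discNormR n p' s' r g := by
  rw [discNormR_congr n p s r hf.ae_eq_mk, discNormR_congr n p' s' r hg.ae_eq_mk]
  refine le_trans (le_of_eq ?_)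
    (holder_disc_meas n p s p' s' hp hs hr hf.measurable_mk hg.measurable_mk)
  apply lintegral_congr_ae
  filter_upwards [hf.ae_eq_mk, hg.ae_eq_mk] with x h1 h2
  rw [← h1, ← h2]

lemma discNormR_dil (n : ℕ) (p s : Fin n → ℝ≥0∞) (hp : ∀ i, p i ≠ 0) (hs : ∀ i, s i ≠ 0)
    (α : ℝ≥0∞) {r : ℝ} (hr : 0 < r) (h : (Fin n → ℝ) → ℝ) :
    discNormR n p s r (dil n α r h) =
      ENNReal.ofReal (r ^ (-((n : ℝ) * (1 / α).toReal) + invSum n p)) * discNorm n p s h := by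
  unfold discNorm discNormR
  rw [← mixedSeq_const_mul n s hs ENNReal.ofReal_ne_top]
  congr 1
  ext k
  unfold mixedLp
  rw [Real.rpow_add hr, ENNReal.ofReal_mul (by positivity), mul_assoc,
    ← mixedE_scale n p hp hr, ← mixedE_const_mul n p hp ENNReal.ofReal_ne_top]
  congr 1
  ext x
  by_cases hx : x ∈ qcube n r k
  · have hx' := (qcube_scale n hr k x).1 hx
    simp only [Set.indicator_of_mem hx, Set.indicator_of_mem hx', dil, nnnorm_mul,
      ENNReal.coe_mul]
    congr 1
    rw [← enorm_eq_nnnorm, Real.enorm_of_nonneg (by positivity)]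
  · have hx' := fun h => hx ((qcube_scale n hr k x).2 h)
    simp [Set.indicator_of_notMem hx, Set.indicator_of_notMem hx']

lemma aemeasurable_dil (n : ℕ) (α : ℝ≥0∞) {r : ℝ} (hr : 0 < r) {h : (Fin n → ℝ) → ℝ}
    (hh : AEMeasurable h) : AEMeasurable (dil n α r h) := by
  unfold dil
  apply AEMeasurable.const_mul
  have h0 : r⁻¹ ≠ 0 := by positivity
  have : Measure.QuasiMeasurePreserving (fun x : Fin n → ℝ => r⁻¹ • x) volume volume := by
    refine ⟨measurable_const_smul _, ?_⟩
    have := Measure.map_addHaar_smul (volume : Measure (Fin n → ℝ)) h0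
    rw [this]
    exact Measure.smul_absolutelyContinuous
  exact hh.comp_quasiMeasurePreserving this

lemma block_bound (n : ℕ) (p s p' s' : Fin n → ℝ≥0∞) (α α' : ℝ≥0∞)
    (hp' : ∀ i, 1 / p i + 1 / p' i = 1) (hs' : ∀ i, 1 / s i + 1 / s' i = 1)
    (hαα' : 1 / α + 1 / α' = 1) {r : ℝ} (hr : 0 < r) {h g : (Fin n → ℝ) → ℝ}
    (hh : AEMeasurable h) (hg : AEMeasurable g) (h1 : discNorm n p' s' h ≤ 1) :
    ∫⁻ x, (‖g x‖₊ : ℝ≥0∞) * ‖dil n α' r h x‖₊ ≤ discNormA n p s α g := by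
  have tr {a b : ℝ≥0∞} (hab : 1 / a + 1 / b = 1) : (1 / a).toReal + (1 / b).toReal = 1 := by
    rw [← ENNReal.toReal_add, hab, ENNReal.toReal_one]
    · rintro h; simp [h] at hab
    · rintro h; simp [h] at hab
  have ne0 {a b : ℝ≥0∞} (hab : 1 / a + 1 / b = 1) : b ≠ 0 := by
    rintro rfl; simp at hab
  refine (holder_disc n p s p' s' hp' hs' hr hg (aemeasurable_dil n α' hr hh)).trans ?_
  rw [discNormR_dil n p' s' (fun i => ne0 (hp' i)) (fun i => ne0 (hs' i)) α' hr]
  have hsum : invSum n p + invSum n p' = n := by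
    unfold invSum
    rw [← Finset.sum_add_distrib]
    simp_rw [fun i => tr (hp' i)]
    simp
  have he : -((n : ℝ) * (1 / α').toReal) + invSum n p' =
      (n : ℝ) * (1 / α).toReal - invSum n p := by
    linear_combination hsum - (n : ℝ) * tr hαα'
  rw [he]
  refine le_trans ?_ (le_iSup₂ (f := fun (r : ℝ) (_ : 0 < r) =>
    ENNReal.ofReal (r ^ ((n : ℝ) * (1 / α).toReal - invSum n p)) * discNormR n p s r g) r hr)
  calc _ ≤ discNormR n p s r g *
        (ENNReal.ofReal (r ^ ((n : ℝ) * (1 / α).toReal - invSum n p)) * 1) := by gcongr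
    _ = _ := by rw [mul_one, mul_comm]

lemma decomp_bound (n : ℕ) (p s p' s' : Fin n → ℝ≥0∞) (α α' : ℝ≥0∞)
    (hp' : ∀ i, 1 / p i + 1 / p' i = 1) (hs' : ∀ i, 1 / s i + 1 / s' i = 1)
    (hαα' : 1 / α + 1 / α' = 1) {f g : (Fin n → ℝ) → ℝ}
    (hf : AEMeasurable f) (hg : AEMeasurable g)
    {c : ℕ → ℝ} {rr : ℕ → ℝ} {h : ℕ → (Fin n → ℝ) → ℝ}
    (H : BlockDecomp n p' s' α' f c rr h) :
    ∫⁻ x, ‖f x * g x‖ₑ ≤ discNormA n p s α g * ENNReal.ofReal (∑' j, |c j|) := by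
  have hm (j : ℕ) : AEMeasurable (dil n α' (rr j) (h j)) :=
    aemeasurable_dil n α' (H.rpos j) (H.gloc j).aestronglyMeasurable.aemeasurable
  set T : (Fin n → ℝ) → ℝ≥0∞ := fun x =>
    ∑' j, ENNReal.ofReal |c j| * (‖dil n α' (rr j) (h j) x‖₊ : ℝ≥0∞) with hT
  have hTm : AEMeasurable T :=
    AEMeasurable.ennreal_tsum fun j => ((hm j).nnnorm.coe_nnreal_ennreal).const_mul _
  have hle (J : ℕ) (x : Fin n → ℝ) : (‖f x‖₊ : ℝ≥0∞) - T x ≤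
      (‖f x - ∑ j ∈ Finset.range J, c j * dil n α' (rr j) (h j) x‖₊ : ℝ≥0∞) := by
    rw [tsub_le_iff_right]
    set S := ∑ j ∈ Finset.range J, c j * dil n α' (rr j) (h j) x with hS
    have h1 : (‖f x‖₊ : ℝ≥0∞) ≤ ‖f x - S‖₊ + ‖S‖₊ := by
      have : ‖f x‖₊ ≤ ‖f x - S‖₊ + ‖S‖₊ := by
        simpa using nnnorm_add_le (f x - S) S
      exact_mod_cast this
    refine h1.trans (add_le_add le_rfl ?_)
    have h2 : (‖S‖₊ : ℝ≥0∞) ≤ ∑ j ∈ Finset.range J,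
        ENNReal.ofReal |c j| * (‖dil n α' (rr j) (h j) x‖₊ : ℝ≥0∞) := by
      have h3 : ‖S‖₊ ≤ ∑ j ∈ Finset.range J, ‖c j * dil n α' (rr j) (h j) x‖₊ :=
        nnnorm_sum_le _ _
      have h4 : (‖S‖₊ : ℝ≥0∞) ≤
          ∑ j ∈ Finset.range J, (‖c j * dil n α' (rr j) (h j) x‖₊ : ℝ≥0∞) := by
        exact_mod_cast h3
      refine h4.trans (le_of_eq (Finset.sum_congr rfl fun j _ => ?_))
      rw [nnnorm_mul, ENNReal.coe_mul, ← enorm_eq_nnnorm (c j), Real.enorm_eq_ofReal_abs]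
    exact h2.trans (ENNReal.sum_le_tsum _)
  have hK (K : Set (Fin n → ℝ)) (hK : IsCompact K) :
      ∀ᵐ x ∂(volume.restrict K), (‖f x‖₊ : ℝ≥0∞) ≤ T x := by
    have h0 : ∫⁻ x in K, ((‖f x‖₊ : ℝ≥0∞) - T x) = 0 := by
      refine le_antisymm (ge_of_tendsto' (H.conv K hK) fun J => ?_) bot_le
      exact lintegral_mono fun x => hle J x
    have hsm : AEMeasurable (fun x => (‖f x‖₊ : ℝ≥0∞) - T x) (volume.restrict K) :=
      (hf.nnnorm.coe_nnreal_ennreal.sub hTm).restrict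
    rw [lintegral_eq_zero_iff' hsm] at h0
    filter_upwards [h0] with x hx
    exact tsub_eq_zero_iff_le.1 hx
  have hae : ∀ᵐ x, (‖f x‖₊ : ℝ≥0∞) ≤ T x := by
    have := (ae_restrict_iUnion_iff (μ := volume)
      (fun N : ℕ => Metric.closedBall (0 : Fin n → ℝ) N)
      (fun x => (‖f x‖₊ : ℝ≥0∞) ≤ T x)).2 fun N => hK _ (isCompact_closedBall _ _)
    rwa [Metric.iUnion_closedBall_nat, Measure.restrict_univ] at this
  calc ∫⁻ x, ‖f x * g x‖ₑ ≤ ∫⁻ x, ∑' j, ENNReal.ofReal |c j| *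
        ((‖g x‖₊ : ℝ≥0∞) * ‖dil n α' (rr j) (h j) x‖₊) := by
        apply lintegral_mono_ae
        filter_upwards [hae] with x hx
        rw [enorm_mul, enorm_eq_nnnorm, enorm_eq_nnnorm]
        refine (mul_le_mul_left hx _).trans (le_of_eq ?_)
        rw [hT, ← ENNReal.tsum_mul_right]
        congr 1
        ext j
        ring
    _ = ∑' j, ENNReal.ofReal |c j| *
        ∫⁻ x, ((‖g x‖₊ : ℝ≥0∞) * ‖dil n α' (rr j) (h j) x‖₊) := by
        rw [lintegral_tsum (f := fun j x => ENNReal.ofReal |c j| *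
          ((‖g x‖₊ : ℝ≥0∞) * ‖dil n α' (rr j) (h j) x‖₊)) fun j =>
          (hg.nnnorm.coe_nnreal_ennreal.mul (hm j).nnnorm.coe_nnreal_ennreal).const_mul _]
        congr 1
        ext j
        exact lintegral_const_mul' _ _ ENNReal.ofReal_ne_top
    _ ≤ ∑' j, ENNReal.ofReal |c j| * discNormA n p s α g := by
        apply ENNReal.tsum_le_tsum
        intro j
        gcongr
        exact block_bound n p s p' s' α α' hp' hs' hαα' (H.rpos j)
          (H.gloc j).aestronglyMeasurable.aemeasurable hg (H.gnorm j)
    _ = _ := by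
        rw [ENNReal.tsum_mul_right, mul_comm,
          ENNReal.ofReal_tsum_of_nonneg (fun j => abs_nonneg _) H.csummable]

/-- If `g ∈ (L^{p⃗},ℓ^{s⃗})^α(ℝⁿ)` and `f ∈ H(p⃗',s⃗',α')`
then `fg ∈ L¹(ℝⁿ)` and `|∫ fg| ≤ ‖g‖_{p⃗,s⃗,α} ‖f‖_{H(p⃗',s⃗',α')}`. -/
theorem statement11 (n : ℕ) (hn : 1 ≤ n) (p s p' s' : Fin n → ℝ≥0∞) (α α' : ℝ≥0∞)
    (hp : ∀ i, 1 ≤ p i) (hs : ∀ i, 1 ≤ s i) (hα : 1 ≤ α)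
    (hα1 : invSum n s / (n : ℝ) ≤ (1 / α).toReal)
    (hα2 : (1 / α).toReal ≤ invSum n p / (n : ℝ))
    (hp' : ∀ i, 1 / p i + 1 / p' i = 1) (hs' : ∀ i, 1 / s i + 1 / s' i = 1)
    (hαα' : 1 / α + 1 / α' = 1) :
    ∀ g : (Fin n → ℝ) → ℝ, memDA n p s α g →
      ∀ f : (Fin n → ℝ) → ℝ, memH n p' s' α' f →
        Integrable (fun x => f x * g x) volume ∧
        ENNReal.ofReal |∫ x, f x * g x| ≤ discNormA n p s α g * hNorm n p' s' α' f := by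
  intro g hg f hf
  have hgm := hg.1.aestronglyMeasurable.aemeasurable
  have hfm := hf.1.aestronglyMeasurable.aemeasurable
  have key : ∀ c rr h, BlockDecomp n p' s' α' f c rr h →
      ∫⁻ x, ‖f x * g x‖ₑ ≤ discNormA n p s α g * ENNReal.ofReal (∑' j, |c j|) :=
    fun c rr h H => decomp_bound n p s p' s' α α' hp' hs' hαα' hfm hgm H
  obtain ⟨c, rr, h, H⟩ := hf.2
  have htop : discNormA n p s α g ≠ ∞ := hg.2.ne
  refine ⟨⟨(hfm.mul hgm).aestronglyMeasurable, ?_⟩, ?_⟩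
  · exact (key c rr h H).trans_lt (ENNReal.mul_lt_top hg.2 ENNReal.ofReal_lt_top)
  · have h1 : ENNReal.ofReal |∫ x, f x * g x| ≤ ∫⁻ x, ‖f x * g x‖ₑ := by
      rw [← Real.enorm_eq_ofReal_abs]
      exact enorm_integral_le_lintegral_enorm _
    refine h1.trans ?_
    by_cases h0 : discNormA n p s α g = 0
    · have := key c rr h H
      rw [h0, zero_mul] at this ⊢
      exact this
    · rw [mul_comm, ← ENNReal.div_le_iff h0 htop]
      unfold hNorm
      refine le_iInf fun c => le_iInf fun rr => le_iInf fun h => le_iInf fun H => ?_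
      rw [ENNReal.div_le_iff h0 htop, mul_comm]
      exact key c rr h H

end MixedAmalgam

end
end
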